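/- arXiv:1310.4112 — 2 statements merged into one kernel-verified Lean document; each statement's English description precedes it below -/
import Mathlib

section
/- Let G be a simple graph on {1,…,n} such that E_G is finite-dimensional, and let d₀ be the largest d with E_G^{d₀} ≠ 0. Then the coefficients of the Hilbert series of E_G are symmetric: for every d with 0 ≤ d ≤ d₀, dim_ℚ E_G^d = dim_ℚ E_G^{d₀ − d}. -/
open scoped TensorProduct

namespace FK

/-- Defining relations of the Fomin–Kirillov algebra `E n`, with generators indexed by
ordered pairs `(i, j)`; we also impose `x_{ii} = 0` and the antisymmetry `x_{ji} = -x_{ij}`,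
so that the generators of the algebra are the `x_{ij}` for `i < j`. -/
inductive Rel (n : ℕ) : FreeAlgebra ℚ (Fin n × Fin n) → FreeAlgebra ℚ (Fin n × Fin n) → Prop
  | diag (i : Fin n) : Rel n (FreeAlgebra.ι ℚ (i, i)) 0
  | antisymm (i j : Fin n) (hij : i ≠ j) :
      Rel n (FreeAlgebra.ι ℚ (j, i)) (-FreeAlgebra.ι ℚ (i, j))
  | square (i j : Fin n) (hij : i ≠ j) :
      Rel n (FreeAlgebra.ι ℚ (i, j) * FreeAlgebra.ι ℚ (i, j)) 0
  | comm (i j k l : Fin n) (h : List.Nodup [i, j, k, l]) :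
      Rel n (FreeAlgebra.ι ℚ (i, j) * FreeAlgebra.ι ℚ (k, l))
        (FreeAlgebra.ι ℚ (k, l) * FreeAlgebra.ι ℚ (i, j))
  | cyclic (i j k : Fin n) (h : List.Nodup [i, j, k]) :
      Rel n (FreeAlgebra.ι ℚ (i, j) * FreeAlgebra.ι ℚ (j, k)
        + FreeAlgebra.ι ℚ (j, k) * FreeAlgebra.ι ℚ (k, i)
        + FreeAlgebra.ι ℚ (k, i) * FreeAlgebra.ι ℚ (i, j)) 0

/-- The Fomin–Kirillov algebra `E n`. -/
abbrev E (n : ℕ) : Type := RingQuot (Rel n)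

/-- The generator `x_{ij}` of `E n`. -/
noncomputable def x (n : ℕ) (i j : Fin n) : E n :=
  RingQuot.mkAlgHom ℚ (Rel n) (FreeAlgebra.ι ℚ (i, j))

/-- The product of generators `x_{i₁j₁} ⋯ x_{i_d j_d}` given by a list of pairs. -/
noncomputable def word (n : ℕ) (l : List (Fin n × Fin n)) : E n :=
  (l.map fun p => x n p.1 p.2).prod

/-- The degree-`d` component of `E n`: the span of products of `d` generators. -/
def degSpan (n : ℕ) (d : ℕ) : Submodule ℚ (E n) :=
  Submodule.span ℚ {y | ∃ l : List (Fin n × Fin n),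
    (∀ p ∈ l, p.1 ≠ p.2) ∧ l.length = d ∧ y = word n l}

/-- The Fomin–Kirillov algebra of a graph `G`: the subalgebra of `E n` generated by the
`x_{ij}` with `{i,j}` an edge of `G`. -/
def EG (n : ℕ) (G : SimpleGraph (Fin n)) : Subalgebra ℚ (E n) :=
  Algebra.adjoin ℚ {y | ∃ i j : Fin n, G.Adj i j ∧ y = x n i j}

/-- The degree-`d` component `E_G^d = E_G ∩ E_n^d`. -/
def EGdeg (n : ℕ) (G : SimpleGraph (Fin n)) (d : ℕ) : Submodule ℚ (E n) :=
  (EG n G).toSubmodule ⊓ degSpan n d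

/-- The positive-degree part `E_G⁺` of `E_G`. -/
def EGplus (n : ℕ) (G : SimpleGraph (Fin n)) : Submodule ℚ (E n) :=
  ⨆ d : ℕ, ⨆ _ : 1 ≤ d, EGdeg n G d


section Aux

set_option maxSynthPendingDepth 3

/-- Ring structure on `E n` built directly on top of its semiring structure. -/
noncomputable local instance (priority := high) ringE (n : ℕ) : Ring (E n) := Algebra.semiringToRing ℚ

noncomputable local instance (priority := high) subE (n : ℕ) : Sub (E n) := (ringE n).toSub

noncomputable local instance (priority := high) negE (n : ℕ) : Neg (E n) := (ringE n).toNeg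

noncomputable local instance (priority := high) acgE (n : ℕ) : AddCommGroup (E n) :=
  (ringE n).toAddCommGroup

/-- A family satisfying the Fomin–Kirillov relations. -/
structure IsFK {n : ℕ} {B : Type*} [Ring B] (y : Fin n → Fin n → B) : Prop where
  diag : ∀ i, y i i = 0
  antisymm : ∀ i j, i ≠ j → y j i = - y i j
  square : ∀ i j, i ≠ j → y i j * y i j = 0
  comm : ∀ i j k l, List.Nodup [i, j, k, l] → y i j * y k l = y k l * y i j
  cyclic : ∀ i j k, List.Nodup [i, j, k] →
    y i j * y j k + y j k * y k i + y k i * y i j = 0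

theorem isFK_x (n : ℕ) : IsFK (x n) where
  diag i := by
    have := RingQuot.mkAlgHom_rel ℚ (Rel.diag (n := n) i)
    simpa [x] using this
  antisymm i j h := by
    have := RingQuot.mkAlgHom_rel ℚ (Rel.antisymm (n := n) i j h)
    simpa [x] using this
  square i j h := by
    have := RingQuot.mkAlgHom_rel ℚ (Rel.square (n := n) i j h)
    simpa [x] using this
  comm i j k l h := by
    have := RingQuot.mkAlgHom_rel ℚ (Rel.comm (n := n) i j k l h)
    simpa [x] using this
  cyclic i j k h := by
    have := RingQuot.mkAlgHom_rel ℚ (Rel.cyclic (n := n) i j k h)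
    simpa [x] using this

theorem exists_lift {n : ℕ} {B : Type*} [Ring B] [Algebra ℚ B] {y : Fin n → Fin n → B}
    (hy : IsFK y) : ∃ φ : E n →ₐ[ℚ] B, ∀ i j, φ (x n i j) = y i j := by
  refine ⟨RingQuot.liftAlgHom ℚ ⟨FreeAlgebra.lift ℚ (fun p => y p.1 p.2), ?_⟩, ?_⟩
  · intro a b h
    cases h with
    | diag i => simpa using hy.diag i
    | antisymm i j h => simpa using hy.antisymm i j h
    | square i j h => simpa using hy.square i j h
    | comm i j k l h => simpa using hy.comm i j k l h
    | cyclic i j k h => simpa using hy.cyclic i j k h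
  · intro i j
    simp [x]

/-- The algebra map induced by a family satisfying the relations. -/
noncomputable def liftE {n : ℕ} {B : Type*} [Ring B] [Algebra ℚ B] {y : Fin n → Fin n → B}
    (hy : IsFK y) : E n →ₐ[ℚ] B := (exists_lift hy).choose

theorem liftE_x {n : ℕ} {B : Type*} [Ring B] [Algebra ℚ B] {y : Fin n → Fin n → B}
    (hy : IsFK y) (i j : Fin n) : liftE hy (x n i j) = y i j := (exists_lift hy).choose_spec i j

theorem homE_ext {n : ℕ} {B : Type*} [Ring B] [Algebra ℚ B] {φ ψ : E n →ₐ[ℚ] B}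
    (h : ∀ i j, φ (x n i j) = ψ (x n i j)) : φ = ψ := by
  apply RingQuot.ringQuot_ext'
  apply FreeAlgebra.hom_ext
  funext p
  exact h p.1 p.2

theorem isFK_perm {n : ℕ} {B : Type*} [Ring B] {y : Fin n → Fin n → B} (hy : IsFK y)
    (σ : Equiv.Perm (Fin n)) : IsFK (fun i j => y (σ i) (σ j)) where
  diag i := hy.diag _
  antisymm i j h := hy.antisymm _ _ (by simpa using h)
  square i j h := hy.square _ _ (by simpa using h)
  comm i j k l h := hy.comm _ _ _ _ (by simpa using h)
  cyclic i j k h := hy.cyclic _ _ _ (by simpa using h)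

/-- The action of a permutation. -/
noncomputable def perm (n : ℕ) (σ : Equiv.Perm (Fin n)) : E n →ₐ[ℚ] E n :=
  liftE (isFK_perm (isFK_x n) σ)

theorem perm_x (n : ℕ) (σ : Equiv.Perm (Fin n)) (i j : Fin n) :
    perm n σ (x n i j) = x n (σ i) (σ j) := liftE_x _ _ _

theorem perm_perm (n : ℕ) (σ τ : Equiv.Perm (Fin n)) (a : E n) :
    perm n σ (perm n τ a) = perm n (σ * τ) a := by
  have : (perm n σ).comp (perm n τ) = perm n (σ * τ) := by
    apply homE_ext
    intro i j
    simp [perm_x]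
  exact DFunLike.congr_fun this a

theorem perm_one (n : ℕ) (a : E n) : perm n 1 a = a := by
  have : perm n 1 = AlgHom.id ℚ (E n) := by
    apply homE_ext
    intro i j
    simp [perm_x]
  exact DFunLike.congr_fun this a

section Abstract

variable {A : Type*} [Ring A] [Algebra ℚ A]

/-- The space of linear maps from functionals to operators. -/
abbrev VV (A : Type*) [Ring A] [Algebra ℚ A] : Type _ :=
  Module.Dual ℚ A →ₗ[ℚ] (A →ₗ[ℚ] A)

/-- The operators on that space. -/
abbrev EndV (A : Type*) [Ring A] [Algebra ℚ A] : Type _ := Module.End ℚ (VV A)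

/-- The functional `q ↦ f (a q)`. -/
noncomputable def pre (a : A) : Module.Dual ℚ A →ₗ[ℚ] Module.Dual ℚ A where
  toFun f := f ∘ₗ LinearMap.mulLeft ℚ a
  map_add' f g := by ext; simp
  map_smul' c f := by ext; simp

@[simp] theorem pre_apply (a : A) (f : Module.Dual ℚ A) (b : A) : pre a f b = f (a * b) := rfl

/-- The twisted operator `T ↦ (f ↦ T (f ∘ a) g - T f a g)`. -/
noncomputable def XX (a : A) (g : A →ₗ[ℚ] A) : EndV A where
  toFun T :=
    { toFun := fun f => T (pre a f) ∘ₗ g - T f ∘ₗ LinearMap.mulLeft ℚ a ∘ₗ g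
      map_add' := by intro f h; ext; simp; abel
      map_smul' := by intro c f; ext; simp [smul_sub] }
  map_add' := by intro f h; ext; simp; abel
  map_smul' := by intro c f; ext; simp [smul_sub]

theorem XX_apply (a : A) (g : A →ₗ[ℚ] A) (T : VV A) (f : Module.Dual ℚ A) (p : A) :
    XX a g T f p = T (pre a f) (g p) - T f (a * g p) := rfl

theorem XX_mul (a b : A) (g h : A →ₐ[ℚ] A) (T : VV A) (f : Module.Dual ℚ A) (p : A) :
    (XX a g.toLinearMap * XX b h.toLinearMap) T f p =
      T (pre (a * b) f) (h (g p)) - T (pre a f) (b * h (g p))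
        - T (pre b f) (h a * h (g p)) + T f (b * h a * h (g p)) := by
  have : pre b (pre a f) = pre (a * b) f := by ext; simp [mul_assoc]
  rw [Module.End.mul_apply, XX_apply, XX_apply, XX_apply]
  simp only [AlgHom.toLinearMap_apply, this, map_mul, mul_assoc]
  abel

end Abstract

/-- The twisted generator. -/
noncomputable def yy (n : ℕ) (i j : Fin n) : EndV (E n) :=
  XX (x n i j) (perm n (Equiv.swap i j)).toLinearMap

theorem yy_mul (n : ℕ) (i j k l : Fin n) (T : VV (E n)) (f : Module.Dual ℚ (E n)) (p : E n) :
    (yy n i j * yy n k l) T f p =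
      T (pre (x n i j * x n k l) f) (perm n (Equiv.swap k l * Equiv.swap i j) p)
      - T (pre (x n i j) f) (x n k l * perm n (Equiv.swap k l * Equiv.swap i j) p)
      - T (pre (x n k l) f) (x n (Equiv.swap k l i) (Equiv.swap k l j) *
          perm n (Equiv.swap k l * Equiv.swap i j) p)
      + T f (x n k l * x n (Equiv.swap k l i) (Equiv.swap k l j) *
          perm n (Equiv.swap k l * Equiv.swap i j) p) := by
  unfold yy
  rw [XX_mul, perm_perm, perm_x]

theorem pre_zero (n : ℕ) (f : Module.Dual ℚ (E n)) : pre (0 : E n) f = 0 := by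
  ext; simp

theorem pre_add {n : ℕ} (a b : E n) (f : Module.Dual ℚ (E n)) :
    pre (a + b) f = pre a f + pre b f := by
  ext; simp [add_mul]

theorem pre_neg {n : ℕ} (a : E n) (f : Module.Dual ℚ (E n)) :
    pre (-a) f = - pre a f := by
  ext; simp

theorem isFK_yy (n : ℕ) : IsFK (yy n) where
  diag i := by
    ext T f p
    simp [yy, XX_apply, (isFK_x n).diag, pre_zero]
  antisymm i j h := by
    ext T f p
    rw [LinearMap.neg_apply, LinearMap.neg_apply, LinearMap.neg_apply]
    unfold yy
    rw [XX_apply, XX_apply, (isFK_x n).antisymm i j h, pre_neg, Equiv.swap_comm j i]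
    simp only [map_neg, LinearMap.neg_apply, neg_mul]
    abel
  square i j h := by
    ext T f p
    rw [yy_mul]
    simp only [Equiv.swap_apply_left, Equiv.swap_apply_right, (isFK_x n).square i j h, pre_zero,
      (isFK_x n).antisymm i j h]
    simp [(isFK_x n).square i j h]
  comm i j k l h := by
    ext T f p
    rw [yy_mul, yy_mul]
    simp only [List.nodup_cons, List.mem_cons, List.not_mem_nil, or_false, not_or] at h
    obtain ⟨⟨h1, h2, h3⟩, ⟨h4, h5⟩, h6, -⟩ := h
    have hc : Equiv.swap i j * Equiv.swap k l = Equiv.swap k l * Equiv.swap i j := by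
      ext m
      simp only [Equiv.Perm.mul_apply, Equiv.swap_apply_def]
      grind
    rw [hc, Equiv.swap_apply_of_ne_of_ne h2 h3, Equiv.swap_apply_of_ne_of_ne h4 h5,
      Equiv.swap_apply_of_ne_of_ne (Ne.symm h2) (Ne.symm h4),
      Equiv.swap_apply_of_ne_of_ne (Ne.symm h3) (Ne.symm h5),
      (isFK_x n).comm i j k l (by simp; tauto)]
    abel
  cyclic i j k h := by
    have hx := (isFK_x n).cyclic i j k h
    simp only [List.nodup_cons, List.mem_cons, List.not_mem_nil, or_false, not_or] at h
    obtain ⟨⟨h1, h2⟩, h3, -⟩ := h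
    ext T f p
    rw [LinearMap.add_apply, LinearMap.add_apply, LinearMap.add_apply, LinearMap.add_apply,
      LinearMap.add_apply, LinearMap.add_apply, yy_mul, yy_mul, yy_mul]
    have hc1 : Equiv.swap k i * Equiv.swap j k = Equiv.swap j k * Equiv.swap i j := by
      ext m
      simp only [Equiv.Perm.mul_apply, Equiv.swap_apply_def]
      grind
    have hc2 : Equiv.swap i j * Equiv.swap k i = Equiv.swap j k * Equiv.swap i j := by
      ext m
      simp only [Equiv.Perm.mul_apply, Equiv.swap_apply_def]
      grind
    rw [hc1, hc2, Equiv.swap_apply_of_ne_of_ne h1 h2, Equiv.swap_apply_left,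
      Equiv.swap_apply_of_ne_of_ne h3 (Ne.symm h1), Equiv.swap_apply_left,
      Equiv.swap_apply_of_ne_of_ne (Ne.symm h2) (Ne.symm h3), Equiv.swap_apply_left,
      (isFK_x n).antisymm k i (Ne.symm h2), (isFK_x n).antisymm i j h1,
      (isFK_x n).antisymm j k h3]
    set q := perm n (Equiv.swap j k * Equiv.swap i j) p
    have e1 : T (pre (x n i j * x n j k) f) q + T (pre (x n j k * x n k i) f) q
        + T (pre (x n k i * x n i j) f) q = 0 := by
      rw [← LinearMap.add_apply, ← LinearMap.add_apply, ← map_add, ← map_add, ← pre_add, ← pre_add,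
        hx, pre_zero]
      simp
    have e2 : T f (x n i j * x n j k * q) + T f (x n j k * x n k i * q)
        + T f (x n k i * x n i j * q) = 0 := by
      rw [← map_add, ← map_add, ← add_mul, ← add_mul, hx]
      simp
    simp only [mul_neg, neg_mul, map_neg, LinearMap.zero_apply]
    calc _ = (T (pre (x n i j * x n j k) f) q + T (pre (x n j k * x n k i) f) q
        + T (pre (x n k i * x n i j) f) q) - (T f (x n i j * x n j k * q)
        + T f (x n j k * x n k i * q) + T f (x n k i * x n i j * q)) := by abel
      _ = 0 := by rw [e1, e2, sub_zero]

/-- The initial element. -/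
noncomputable def T1 (n : ℕ) : VV (E n) where
  toFun f := f 1 • LinearMap.id
  map_add' f g := by ext; simp [add_smul]
  map_smul' c f := by ext; simp [mul_smul]

/-- The twisted coproduct. -/
noncomputable def TT (n : ℕ) (b : E n) : VV (E n) := liftE (isFK_yy n) b (T1 n)

theorem TT_x_mul (n : ℕ) (i j : Fin n) (b : E n) (f : Module.Dual ℚ (E n)) (p : E n) :
    TT n (x n i j * b) f p = TT n b (pre (x n i j) f) (perm n (Equiv.swap i j) p)
      - TT n b f (x n i j * perm n (Equiv.swap i j) p) := by
  unfold TT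
  rw [map_mul, Module.End.mul_apply, liftE_x, yy, XX_apply]
  rfl

/-- Lists of edges of a graph. -/
def Edges {n : ℕ} (G : SimpleGraph (Fin n)) (l : List (Fin n × Fin n)) : Prop :=
  ∀ p ∈ l, G.Adj p.1 p.2

theorem word_cons (n : ℕ) (p : Fin n × Fin n) (l : List (Fin n × Fin n)) :
    word n (p :: l) = x n p.1 p.2 * word n l := by simp [word]

theorem word_append (n : ℕ) (l lt : List (Fin n × Fin n)) :
    word n (l ++ lt) = word n l * word n lt := by simp [word]

theorem word_nil (n : ℕ) : word n [] = 1 := by simp [word]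

theorem Edges.cons {n : ℕ} {G : SimpleGraph (Fin n)} {p : Fin n × Fin n}
    {l : List (Fin n × Fin n)} (hp : G.Adj p.1 p.2) (hl : Edges G l) : Edges G (p :: l) := by
  intro q hq
  rcases List.mem_cons.1 hq with rfl | h
  · exact hp
  · exact hl q h

theorem TT_vanish {n : ℕ} {G : SimpleGraph (Fin n)} (l : List (Fin n × Fin n)) (hl : Edges G l)
    (f : Module.Dual ℚ (E n))
    (hf : ∀ lt, Edges G lt → lt.length ≤ l.length → f (word n lt) = 0) :
    TT n (word n l) f = 0 := by
  induction l generalizing f with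
  | nil =>
    have := hf [] hl le_rfl
    rw [word_nil] at this
    simp [word_nil, TT, T1, this]
  | cons p l ih =>
    have hp : G.Adj p.1 p.2 := hl p (by simp)
    have hlt : Edges G l := fun q hq => hl q (by simp [hq])
    ext q
    rw [word_cons, TT_x_mul, ih hlt f, ih hlt (pre _ f)]
    · simp
    · intro lt h1 h2
      rw [pre_apply, ← word_cons]
      exact hf _ (h1.cons hp) (by simpa using h2)
    · intro lt h1 h2
      exact hf _ h1 (by simp; omega)

theorem TT_lead {n : ℕ} {G : SimpleGraph (Fin n)} (l : List (Fin n × Fin n)) (hl : Edges G l)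
    (f : Module.Dual ℚ (E n))
    (hf : ∀ lt, Edges G lt → lt.length < l.length → f (word n lt) = 0) :
    ∃ σ : Equiv.Perm (Fin n), ∀ p, TT n (word n l) f p = f (word n l) • perm n σ p := by
  induction l generalizing f with
  | nil => exact ⟨1, fun p => by simp [word_nil, TT, T1, perm_one]⟩
  | cons p l ih =>
    have hp : G.Adj p.1 p.2 := hl p (by simp)
    have hlt : Edges G l := fun q hq => hl q (by simp [hq])
    obtain ⟨σ, hσ⟩ := ih hlt (pre (x n p.1 p.2) f) (by
      intro lt h1 h2
      rw [pre_apply, ← word_cons]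
      exact hf _ (h1.cons hp) (by simpa using h2))
    refine ⟨σ * Equiv.swap p.1 p.2, fun q => ?_⟩
    rw [word_cons, TT_x_mul, hσ, perm_perm, pre_apply, TT_vanish l hlt f]
    · simp
    · intro lt h1 h2
      exact hf _ h1 (by simp; omega)

open Polynomial in
theorem isFK_gr (n : ℕ) : IsFK (fun i j => (monomial 1 (x n i j) : (E n)[X])) where
  diag i := by simp [(isFK_x n).diag]
  antisymm i j h := by rw [(isFK_x n).antisymm i j h, map_neg]
  square i j h := by rw [monomial_mul_monomial, (isFK_x n).square i j h, map_zero]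
  comm i j k l h := by
    rw [monomial_mul_monomial, monomial_mul_monomial, (isFK_x n).comm i j k l h]
  cyclic i j k h := by
    simp only [monomial_mul_monomial]
    rw [← map_add, ← map_add, (isFK_x n).cyclic i j k h, map_zero]

open Polynomial in
/-- The grading map. -/
noncomputable def gr (n : ℕ) : E n →ₐ[ℚ] (E n)[X] := liftE (isFK_gr n)

open Polynomial in
theorem gr_word (n : ℕ) (l : List (Fin n × Fin n)) :
    gr n (word n l) = monomial l.length (word n l) := by
  induction l with
  | nil => simp [word_nil]
  | cons p l ih =>
    rw [word_cons, map_mul, ih, gr, liftE_x, monomial_mul_monomial, List.length_cons, add_comm]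

/-- Projection to degree `d`. -/
noncomputable def proj (n d : ℕ) : E n →ₗ[ℚ] E n where
  toFun a := (gr n a).coeff d
  map_add' := by simp
  map_smul' := by simp

theorem proj_word (n d : ℕ) (l : List (Fin n × Fin n)) :
    proj n d (word n l) = if l.length = d then word n l else 0 := by
  change (gr n (word n l)).coeff d = _
  rw [gr_word, Polynomial.coeff_monomial]

theorem proj_of_mem {n d : ℕ} {a : E n} (ha : a ∈ degSpan n d) : proj n d a = a := by
  induction ha using Submodule.span_induction with
  | mem y hy =>
    obtain ⟨l, -, h, rfl⟩ := hy
    rw [proj_word, if_pos h]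
  | zero => simp
  | add a b _ _ h1 h2 => rw [map_add, h1, h2]
  | smul c a _ h => rw [map_smul, h]

theorem word_mem_EG {n : ℕ} {G : SimpleGraph (Fin n)} {l : List (Fin n × Fin n)}
    (hl : Edges G l) : word n l ∈ EG n G := by
  apply Subalgebra.list_prod_mem
  intro y hy
  obtain ⟨p, hp, rfl⟩ := List.mem_map.1 hy
  exact Algebra.subset_adjoin ⟨p.1, p.2, hl p hp, rfl⟩

theorem word_mem_degSpan {n : ℕ} {G : SimpleGraph (Fin n)} {l : List (Fin n × Fin n)}
    (hl : Edges G l) : word n l ∈ degSpan n l.length :=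
  Submodule.subset_span ⟨l, fun p hp => (hl p hp).ne, rfl, rfl⟩

theorem EG_le_span (n : ℕ) (G : SimpleGraph (Fin n)) {a : E n} (ha : a ∈ EG n G) :
    a ∈ Submodule.span ℚ {y | ∃ l, Edges G l ∧ y = word n l} := by
  unfold EG at ha
  induction ha using Algebra.adjoin_induction with
  | mem y hy =>
    obtain ⟨i, j, h, rfl⟩ := hy
    exact Submodule.subset_span ⟨[(i, j)], by simpa [Edges] using h, by simp [word]⟩
  | algebraMap r =>
    rw [Algebra.algebraMap_eq_smul_one]
    exact Submodule.smul_mem _ _ (Submodule.subset_span ⟨[], by simp [Edges], by simp [word]⟩)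
  | add a b _ _ h1 h2 => exact Submodule.add_mem _ h1 h2
  | mul a b _ _ h1 h2 =>
    have := Submodule.mul_mem_mul h1 h2
    rw [Submodule.span_mul_span] at this
    refine Submodule.span_mono ?_ this
    rintro _ ⟨_, ⟨l, hl, rfl⟩, _, ⟨lt, hlt, rfl⟩, rfl⟩
    refine ⟨l ++ lt, ?_, (word_append n l lt).symm⟩
    intro p hp
    rcases List.mem_append.1 hp with h | h
    · exact hl p h
    · exact hlt p h

theorem EGdeg_le_span (n : ℕ) (G : SimpleGraph (Fin n)) (d : ℕ) {a : E n} (ha : a ∈ EGdeg n G d) :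
    a ∈ Submodule.span ℚ {y | ∃ l, Edges G l ∧ l.length = d ∧ y = word n l} := by
  rw [← proj_of_mem ha.2]
  have := EG_le_span n G ha.1
  clear ha
  induction this using Submodule.span_induction with
  | mem y hy =>
    obtain ⟨l, hl, rfl⟩ := hy
    rw [proj_word]
    split_ifs with h
    · exact Submodule.subset_span ⟨l, hl, h, rfl⟩
    · exact Submodule.zero_mem _
  | zero => simp
  | add a b _ _ h1 h2 => rw [map_add]; exact Submodule.add_mem _ h1 h2
  | smul c a _ h => rw [map_smul]; exact Submodule.smul_mem _ _ h

theorem word_mem_EGdeg {n : ℕ} {G : SimpleGraph (Fin n)} {l : List (Fin n × Fin n)}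
    (hl : Edges G l) : word n l ∈ EGdeg n G l.length :=
  ⟨word_mem_EG hl, word_mem_degSpan hl⟩

theorem TT_socle {n : ℕ} {G : SimpleGraph (Fin n)} (s : E n)
    (hs : ∀ i j, G.Adj i j → x n i j * s = 0) {a : E n} (ha : a ∈ EG n G) :
    ∀ (f : Module.Dual ℚ (E n)) (p : E n), TT n s (pre a f) p = TT n s f (a * p) := by
  unfold EG at ha
  induction ha using Algebra.adjoin_induction with
  | mem y hy =>
    obtain ⟨i, j, h, rfl⟩ := hy
    intro f p
    have h1 := TT_x_mul n i j s f (perm n (Equiv.swap i j) p)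
    rw [hs i j h, perm_perm, Equiv.swap_mul_self, perm_one] at h1
    have h2 : TT n 0 = 0 := by simp [TT]
    rw [h2] at h1
    exact (sub_eq_zero.1 h1.symm)
  | algebraMap r =>
    intro f p
    have : pre (algebraMap ℚ (E n) r) f = r • f := by
      ext q
      rw [pre_apply, ← Algebra.smul_def]
      simp
    rw [this, ← Algebra.smul_def]
    simp
  | add a b _ _ h1 h2 =>
    intro f p
    rw [pre_add, map_add, LinearMap.add_apply, h1, h2, add_mul, map_add]
  | mul a b _ _ h1 h2 =>
    intro f p
    have : pre (a * b) f = pre b (pre a f) := by ext; simp [mul_assoc]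
    rw [this, h2, h1, mul_assoc]

theorem nondeg {n : ℕ} {G : SimpleGraph (Fin n)} {d₀ : ℕ}
    (h₀ : EGdeg n G d₀ ≠ ⊥) (hmax : ∀ d : ℕ, d₀ < d → EGdeg n G d = ⊥) :
    ∃ f : Module.Dual ℚ (E n), ∀ d e : ℕ, d + e = d₀ → ∀ a ∈ EGdeg n G d,
      (∀ b ∈ EGdeg n G e, f (a * b) = 0) → a = 0 := by
  obtain ⟨l, hl, hld, hne⟩ : ∃ l, Edges G l ∧ l.length = d₀ ∧ word n l ≠ 0 := by
    by_contra hcon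
    push Not at hcon
    apply h₀
    rw [eq_bot_iff]
    intro a ha
    have := EGdeg_le_span n G d₀ ha
    refine (Submodule.span_le (p := ⊥)).2 ?_ this
    rintro _ ⟨l, hl, h, rfl⟩
    simpa using hcon l hl h
  obtain ⟨f0, hf0⟩ : ∃ f0 : Module.Dual ℚ (E n), f0 (word n l) ≠ 0 := by
    by_contra hcon
    push Not at hcon
    exact hne ((Module.forall_dual_apply_eq_zero_iff ℚ _).1 hcon)
  set f : Module.Dual ℚ (E n) := f0 ∘ₗ proj n d₀ with hf
  have hfw : ∀ lt, lt.length ≠ d₀ → f (word n lt) = 0 := by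
    intro lt h
    simp [hf, proj_word, h]
  refine ⟨f, fun d e hde a ha hab => ?_⟩
  have hsoc : ∀ i j, G.Adj i j → x n i j * word n l = 0 := by
    intro i j h
    have h1 := word_mem_EGdeg (hl.cons (p := (i, j)) h)
    rw [hmax _ (by simp [hld])] at h1
    rw [← word_cons n (i, j) l]
    simpa using h1
  obtain ⟨σ, hσ⟩ := TT_lead l hl f (by
    intro lt _ h2
    exact hfw lt (by omega))
  have h1 := TT_socle (word n l) hsoc ha.1 f 1
  rw [mul_one, hσ, TT_vanish l hl] at h1
  · have h2 : f (word n l) ≠ 0 := by simpa [hf, proj_word, hld] using hf0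
    have h3 : perm n σ a = 0 := by
      rcases smul_eq_zero.1 h1.symm with h | h
      · exact absurd h h2
      · exact h
    have h4 := perm_perm n σ⁻¹ σ a
    rw [h3, inv_mul_cancel, perm_one, map_zero] at h4
    exact h4.symm
  · intro lt hlt _
    rw [pre_apply]
    by_cases hle : lt.length = e
    · exact hab _ (hle ▸ word_mem_EGdeg hlt)
    · have := EGdeg_le_span n G d ha
      clear hab h1 ha
      induction this using Submodule.span_induction with
      | mem y hy =>
        obtain ⟨l2, _, h, rfl⟩ := hy
        rw [← word_append]
        apply hfw
        simp
        omega
      | zero => simp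
      | add a b _ _ h1 h2 => rw [add_mul, map_add, h1, h2, add_zero]
      | smul c a _ h => rw [smul_mul_assoc, map_smul, h, smul_zero]

theorem finrank_le (n : ℕ) (G : SimpleGraph (Fin n))
    (hfd : FiniteDimensional ℚ ↥(EG n G)) (d₀ : ℕ)
    (h₀ : EGdeg n G d₀ ≠ ⊥) (hmax : ∀ d : ℕ, d₀ < d → EGdeg n G d = ⊥)
    (d e : ℕ) (hde : d + e = d₀) :
    Module.finrank ℚ ↥(EGdeg n G d) ≤ Module.finrank ℚ ↥(EGdeg n G e) := by
  obtain ⟨f, hf⟩ := nondeg h₀ hmax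
  have hfd' : FiniteDimensional ℚ ↥(Subalgebra.toSubmodule (EG n G)) := hfd
  have hfe : FiniteDimensional ℚ ↥(EGdeg n G e) :=
    Submodule.finiteDimensional_of_le (inf_le_left : EGdeg n G e ≤ _)
  rw [← Subspace.dual_finrank_eq (V := ↥(EGdeg n G e))]
  let φ : ↥(EGdeg n G d) →ₗ[ℚ] Module.Dual ℚ ↥(EGdeg n G e) :=
    { toFun := fun a => (pre (a : E n) f) ∘ₗ (EGdeg n G e).subtype
      map_add' := by intro a b; ext c; simp [add_mul]
      map_smul' := by intro r a; ext c; simp }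
  apply LinearMap.finrank_le_finrank_of_injective (f := φ)
  rw [injective_iff_map_eq_zero]
  intro a ha
  apply Subtype.ext
  apply hf d e hde a a.2
  intro b hb
  exact DFunLike.congr_fun ha ⟨b, hb⟩

end Aux

/-- if `E_G` is finite-dimensional with top degree `d₀`, then the Hilbert
series of `E_G` is symmetric: `dim E_G^d = dim E_G^{d₀ - d}` for `0 ≤ d ≤ d₀`. -/
theorem stmt8 (n : ℕ) (hn : 1 ≤ n) (G : SimpleGraph (Fin n))
    (hfd : FiniteDimensional ℚ ↥(EG n G)) (d₀ : ℕ)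
    (h₀ : EGdeg n G d₀ ≠ ⊥) (hmax : ∀ d : ℕ, d₀ < d → EGdeg n G d = ⊥) :
    ∀ d : ℕ, d ≤ d₀ →
      Module.finrank ℚ ↥(EGdeg n G d) = Module.finrank ℚ ↥(EGdeg n G (d₀ - d)) := by
  intro d hd
  apply le_antisymm
  · exact finrank_le n G hfd d₀ h₀ hmax d (d₀ - d) (by omega)
  · exact finrank_le n G hfd d₀ h₀ hmax (d₀ - d) d (by omega)

end FK
end

section
/- Let H be a subgraph of a simple graph G on {1,…,n}. Then, as ℚ-subspaces of E_n, (E_H⁺·E_n) ∩ E_G = E_H⁺·E_G, where E_H⁺·E_n denotes the span of all products h·x with h ∈ E_H⁺ and x ∈ E_n, and E_H⁺·E_G denotes the span of all products h·g with h ∈ E_H⁺ and g ∈ E_G. -/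
open scoped TensorProduct

namespace FK

/-! ### An abstract version of the Fomin–Kirillov algebra -/

/-- The Fomin–Kirillov relations for a family of elements of a ring. -/
structure Rels (n : ℕ) (B : Type) [Ring B] (f : Fin n → Fin n → B) : Prop where
  diag : ∀ i, f i i = 0
  antisymm : ∀ i j, f j i = - f i j
  square : ∀ i j, f i j * f i j = 0
  comm : ∀ i j k l, List.Nodup [i, j, k, l] → f i j * f k l = f k l * f i j
  cyclic : ∀ i j k, List.Nodup [i, j, k] →
      f i j * f j k + f j k * f k i + f k i * f i j = 0

/-- An algebra with the universal property of the Fomin–Kirillov algebra. -/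
structure FKA (n : ℕ) (A : Type) [Ring A] [Algebra ℚ A] where
  X : Fin n → Fin n → A
  rels : Rels n A X
  gen : Algebra.adjoin ℚ {y | ∃ i j : Fin n, y = X i j} = ⊤
  lift : ∀ (B : Type) [Ring B] [Algebra ℚ B] (f : Fin n → Fin n → B), Rels n B f →
    ∃ F : A →ₐ[ℚ] B, ∀ i j, F (X i j) = f i j

namespace FKA

variable {n : ℕ} {A : Type} [Ring A] [Algebra ℚ A] (S : FKA n A)

lemma antisymm (i j : Fin n) : S.X j i = - S.X i j := S.rels.antisymm i j

lemma hom_ext {B : Type} [Ring B] [Algebra ℚ B] (f g : A →ₐ[ℚ] B)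
    (h : ∀ i j, f (S.X i j) = g (S.X i j)) : f = g := by
  apply AlgHom.ext_of_adjoin_eq_top S.gen
  rintro _ ⟨i, j, rfl⟩
  exact h i j

lemma exists_act (s : Equiv.Perm (Fin n)) :
    ∃ F : A →ₐ[ℚ] A, ∀ i j, F (S.X i j) = S.X (s i) (s j) :=
  S.lift A (fun i j => S.X (s i) (s j))
    { diag := fun i => S.rels.diag _
      antisymm := fun i j => S.rels.antisymm _ _
      square := fun i j => S.rels.square _ _
      comm := fun i j k l h => S.rels.comm _ _ _ _ (by simpa using h)
      cyclic := fun i j k h => S.rels.cyclic _ _ _ (by simpa using h) }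

/-- The symmetric group acts on `A`. -/
noncomputable def act (s : Equiv.Perm (Fin n)) : A →ₐ[ℚ] A := (S.exists_act s).choose

lemma act_x (s : Equiv.Perm (Fin n)) (i j : Fin n) :
    S.act s (S.X i j) = S.X (s i) (s j) := (S.exists_act s).choose_spec i j

lemma act_mul (s t : Equiv.Perm (Fin n)) (a : A) :
    S.act s (S.act t a) = S.act (s * t) a := by
  have : (S.act s).comp (S.act t) = S.act (s * t) :=
    S.hom_ext _ _ (fun i j => by simp [act_x])
  exact DFunLike.congr_fun this a

lemma act_one (a : A) : S.act 1 a = a := by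
  have : S.act 1 = AlgHom.id ℚ _ := S.hom_ext _ _ (fun i j => by simp [act_x])
  exact DFunLike.congr_fun this a

/-- The operator by which `x_{ij}` acts on `A ⊗ A` through the braided coproduct. -/
noncomputable def op (i j : Fin n) : Module.End ℚ (A ⊗[ℚ] A) :=
  TensorProduct.map (LinearMap.mulLeft ℚ (S.X i j)) LinearMap.id +
    TensorProduct.map (S.act (Equiv.swap i j)).toLinearMap (LinearMap.mulLeft ℚ (S.X i j))

lemma op_tmul (i j : Fin n) (a b : A) :
    S.op i j (a ⊗ₜ b) = (S.X i j * a) ⊗ₜ b +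
      (S.act (Equiv.swap i j) a) ⊗ₜ (S.X i j * b) := by
  simp [op]

lemma op_op (i j k l : Fin n) (a b : A) :
    S.op i j (S.op k l (a ⊗ₜ b)) =
      ((S.X i j * S.X k l) * a) ⊗ₜ b +
      (S.X i j * S.act (Equiv.swap k l) a) ⊗ₜ (S.X k l * b) +
      (S.X (Equiv.swap i j k) (Equiv.swap i j l) * S.act (Equiv.swap i j) a) ⊗ₜ (S.X i j * b) +
      (S.act (Equiv.swap i j * Equiv.swap k l) a) ⊗ₜ ((S.X i j * S.X k l) * b) := by
  simp only [op_tmul, map_add, map_mul, act_x, act_mul, mul_assoc]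
  abel

lemma op_rels : Rels n (Module.End ℚ (A ⊗[ℚ] A)) S.op where
  diag i := by
    apply TensorProduct.ext'
    intro a b
    simp [op_tmul, S.rels.diag]
  antisymm i j := by
    apply TensorProduct.ext'
    intro a b
    simp only [op_tmul, LinearMap.neg_apply, S.antisymm i j, Equiv.swap_comm j i,
      neg_mul, TensorProduct.neg_tmul, TensorProduct.tmul_neg]
    abel
  square i j := by
    apply TensorProduct.ext'
    intro a b
    simp only [Module.End.mul_apply, op_op, S.rels.square, Equiv.swap_apply_left,
      Equiv.swap_apply_right, S.antisymm i j, neg_mul, TensorProduct.neg_tmul]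
    simp
  comm i j k l h := by
    apply TensorProduct.ext'
    intro a b
    have hc := S.rels.comm i j k l h
    simp only [List.nodup_cons, List.mem_cons, not_or, List.not_mem_nil, not_false_eq_true,
      List.nodup_nil, and_true] at h
    obtain ⟨⟨hij, hik, hil⟩, ⟨hjk, hjl⟩, hkl⟩ := h
    have hs : Equiv.swap i j * Equiv.swap k l = Equiv.swap k l * Equiv.swap i j := by
      apply Equiv.Perm.Disjoint.commute
      intro m
      by_cases h1 : m = i
      · right; subst h1; exact Equiv.swap_apply_of_ne_of_ne hik hil
      by_cases h2 : m = j
      · right; subst h2; exact Equiv.swap_apply_of_ne_of_ne hjk hjl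
      left; exact Equiv.swap_apply_of_ne_of_ne h1 h2
    simp only [Module.End.mul_apply, op_op]
    rw [Equiv.swap_apply_of_ne_of_ne (Ne.symm hik) (Ne.symm hjk),
      Equiv.swap_apply_of_ne_of_ne (Ne.symm hil) (Ne.symm hjl),
      Equiv.swap_apply_of_ne_of_ne hik hil, Equiv.swap_apply_of_ne_of_ne hjk hjl, hs, hc]
    abel
  cyclic i j k h := by
    apply TensorProduct.ext'
    intro a b
    have hc := S.rels.cyclic i j k h
    simp only [List.nodup_cons, List.mem_cons, not_or, List.not_mem_nil, not_false_eq_true,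
      List.nodup_nil, and_true] at h
    obtain ⟨⟨hij, hik⟩, hjk⟩ := h
    have hs1 : Equiv.swap j k * Equiv.swap k i = Equiv.swap i j * Equiv.swap j k := by
      ext m
      simp only [Equiv.Perm.mul_apply, Equiv.swap_apply_def]
      grind
    have hs2 : Equiv.swap k i * Equiv.swap i j = Equiv.swap i j * Equiv.swap j k := by
      ext m
      simp only [Equiv.Perm.mul_apply, Equiv.swap_apply_def]
      grind
    simp only [Module.End.mul_apply, op_op, LinearMap.add_apply, LinearMap.zero_apply, hs1, hs2,
      Equiv.swap_apply_right]
    rw [Equiv.swap_apply_of_ne_of_ne (Ne.symm hik) (Ne.symm hjk),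
      Equiv.swap_apply_of_ne_of_ne hij hik,
      Equiv.swap_apply_of_ne_of_ne hjk (Ne.symm hij)]
    rw [S.antisymm k i, S.antisymm i j, S.antisymm j k]
    have h3 : S.X k i * S.X i j = - (S.X i j * S.X j k) - S.X j k * S.X k i := by
      rw [eq_neg_of_add_eq_zero_right hc]; abel
    rw [h3]
    simp only [sub_mul, neg_mul, TensorProduct.neg_tmul, TensorProduct.tmul_neg,
      TensorProduct.sub_tmul, TensorProduct.tmul_sub]
    abel

/-- The braided coproduct as an action of `A` on `A ⊗ A`. -/
noncomputable def cop : A →ₐ[ℚ] Module.End ℚ (A ⊗[ℚ] A) := (S.lift _ _ S.op_rels).choose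

lemma cop_x (i j : Fin n) : S.cop (S.X i j) = S.op i j := (S.lift _ _ S.op_rels).choose_spec i j

open Polynomial in
lemma exists_poly : ∃ F : A →ₐ[ℚ] A[X], ∀ i j, F (S.X i j) = monomial 1 (S.X i j) :=
  S.lift _ _
    { diag := fun i => by simp [S.rels.diag]
      antisymm := fun i j => by simp [S.antisymm i j]
      square := fun i j => by simp [monomial_mul_monomial, S.rels.square]
      comm := fun i j k l h => by simp [monomial_mul_monomial, S.rels.comm i j k l h]
      cyclic := fun i j k h => by
        simp only [monomial_mul_monomial, ← map_add, S.rels.cyclic i j k h, map_zero] }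

/-- Product of generators. -/
def wd (l : List (Fin n × Fin n)) : A := (l.map fun p => S.X p.1 p.2).prod

lemma wd_cons (p : Fin n × Fin n) (l) : S.wd (p :: l) = S.X p.1 p.2 * S.wd l := by simp [wd]

lemma wd_nil : S.wd [] = 1 := by simp [wd]

lemma wd_append (l m) : S.wd (l ++ m) = S.wd l * S.wd m := by simp [wd]

/-- Homogeneous component. -/
noncomputable def comp (d : ℕ) : A →ₗ[ℚ] A where
  toFun y := (S.exists_poly.choose y).coeff d
  map_add' := by simp
  map_smul' := by simp

lemma comp_wd (d : ℕ) (l) : S.comp d (S.wd l) = if l.length = d then S.wd l else 0 := by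
  have : S.exists_poly.choose (S.wd l) = Polynomial.monomial l.length (S.wd l) := by
    induction l with
    | nil => simp [wd_nil]
    | cons p l ih =>
      rw [wd_cons, map_mul, ih, S.exists_poly.choose_spec, Polynomial.monomial_mul_monomial]
      simp [add_comm]
  simp [comp, this, Polynomial.coeff_monomial]

/-- The subalgebra generated by the `x_{ij}` with `P i j`. -/
def GA (P : Fin n → Fin n → Prop) : Subalgebra ℚ A :=
  Algebra.adjoin ℚ {y | ∃ i j : Fin n, P i j ∧ y = S.X i j}

lemma x_mem_GA {P : Fin n → Fin n → Prop} {i j} (h : P i j) : S.X i j ∈ S.GA P :=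
  Algebra.subset_adjoin ⟨i, j, h, rfl⟩

lemma wd_mem_GA {P : Fin n → Fin n → Prop} {l} (h : ∀ p ∈ l, P p.1 p.2) : S.wd l ∈ S.GA P := by
  induction l with
  | nil => rw [wd_nil]; exact one_mem _
  | cons p l ih =>
    rw [wd_cons]
    exact mul_mem (S.x_mem_GA (h p (by simp))) (ih fun q hq => h q (by simp [hq]))

lemma GA_span {P : Fin n → Fin n → Prop} {y : A} (hy : y ∈ S.GA P) :
    y ∈ Submodule.span ℚ {z | ∃ l, (∀ p ∈ l, P p.1 p.2) ∧ z = S.wd l} := by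
  have h : y ∈ Subalgebra.toSubmodule (S.GA P) := hy
  rw [GA, Algebra.adjoin_eq_span] at h
  refine Submodule.span_mono ?_ h
  intro z hz
  induction hz using Submonoid.closure_induction with
  | mem z hz =>
    obtain ⟨i, j, hij, rfl⟩ := hz
    exact ⟨[(i, j)], by simpa using hij, by simp [wd]⟩
  | one => exact ⟨[], by simp, by simp [wd]⟩
  | mul a b _ _ ha hb =>
    obtain ⟨l, hl, rfl⟩ := ha
    obtain ⟨m, hm, rfl⟩ := hb
    refine ⟨l ++ m, ?_, (S.wd_append l m).symm⟩
    intro p hp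
    rcases List.mem_append.1 hp with h | h
    exacts [hl p h, hm p h]

lemma top_span (y : A) : y ∈ Submodule.span ℚ {z | ∃ l, z = S.wd l} := by
  have : y ∈ S.GA (fun _ _ => True) := by
    have := S.gen
    simp only [GA, true_and]
    rw [this]; trivial
  simpa using S.GA_span this

/-- Span of products of fewer than `d` generators. -/
def F (d : ℕ) : Submodule ℚ A := Submodule.span ℚ {z | ∃ l, l.length < d ∧ z = S.wd l}

lemma F_zero : S.F 0 = ⊥ := by simp [F]

lemma F_mono {d e : ℕ} (h : d ≤ e) : S.F d ≤ S.F e := by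
  apply Submodule.span_mono
  rintro _ ⟨l, hl, rfl⟩
  exact ⟨l, by omega, rfl⟩

lemma wd_mem_F {d : ℕ} {l} (h : l.length < d) : S.wd l ∈ S.F d :=
  Submodule.subset_span ⟨l, h, rfl⟩

lemma x_mul_F (i j) {d : ℕ} {y : A} (h : y ∈ S.F d) : S.X i j * y ∈ S.F (d + 1) := by
  induction h using Submodule.span_induction with
  | mem z hz =>
    obtain ⟨l, hl, rfl⟩ := hz
    rw [← S.wd_cons (i, j)]
    exact S.wd_mem_F (by simpa using hl)
  | zero => simp
  | add a b _ _ ha hb => rw [mul_add]; exact add_mem ha hb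
  | smul r a _ ha => rw [mul_smul_comm]; exact Submodule.smul_mem _ _ ha

lemma exists_F (y : A) : ∃ d, y ∈ S.F d := by
  have h := S.top_span y
  induction h using Submodule.span_induction with
  | mem z hz =>
    obtain ⟨l, rfl⟩ := hz
    exact ⟨l.length + 1, S.wd_mem_F (by omega)⟩
  | zero => exact ⟨0, zero_mem _⟩
  | add a b _ _ ha hb =>
    obtain ⟨d, hd⟩ := ha
    obtain ⟨e, he⟩ := hb
    exact ⟨max d e, add_mem (S.F_mono (le_max_left _ _) hd) (S.F_mono (le_max_right _ _) he)⟩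
  | smul r a _ ha =>
    obtain ⟨d, hd⟩ := ha
    exact ⟨d, Submodule.smul_mem _ _ hd⟩

lemma comp_F {d : ℕ} {y : A} (h : y ∈ S.F d) : S.comp d y = 0 := by
  induction h using Submodule.span_induction with
  | mem z hz =>
    obtain ⟨l, hl, rfl⟩ := hz
    rw [comp_wd, if_neg (by omega)]
  | zero => simp
  | add a b _ _ ha hb => simp [ha, hb]
  | smul r a _ ha => simp [ha]

lemma sub_comp_F {d : ℕ} {y : A} (h : y ∈ S.F (d + 1)) : y - S.comp d y ∈ S.F d := by
  induction h using Submodule.span_induction with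
  | mem z hz =>
    obtain ⟨l, hl, rfl⟩ := hz
    rw [comp_wd]
    split_ifs with h
    · simp
    · rw [sub_zero]; exact S.wd_mem_F (by omega)
  | zero => simp
  | add a b _ _ ha hb =>
    rw [map_add, add_sub_add_comm]; exact add_mem ha hb
  | smul r a _ ha => rw [map_smul, ← smul_sub]; exact Submodule.smul_mem _ _ ha

lemma comp_GA (d : ℕ) {P : Fin n → Fin n → Prop} {y : A} (h : y ∈ S.GA P) :
    S.comp d y ∈ S.GA P := by
  replace h := S.GA_span h
  induction h using Submodule.span_induction with
  | mem z hz =>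
    obtain ⟨l, hl, rfl⟩ := hz
    rw [comp_wd]
    split_ifs
    · exact S.wd_mem_GA hl
    · exact zero_mem _
  | zero => simp
  | add a b _ _ ha hb => rw [map_add]; exact add_mem ha hb
  | smul r a _ ha => rw [map_smul]; exact Subalgebra.smul_mem _ ha _

/-- The positive part of `GA P`. -/
def Kp (P : Fin n → Fin n → Prop) : Submodule ℚ A :=
  Submodule.span ℚ {z | ∃ l, l ≠ [] ∧ (∀ p ∈ l, P p.1 p.2) ∧ z = S.wd l}

lemma Kp_le_GA {P : Fin n → Fin n → Prop} {y : A} (h : y ∈ S.Kp P) : y ∈ S.GA P := by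
  have : S.Kp P ≤ Subalgebra.toSubmodule (S.GA P) := by
    apply Submodule.span_le.2
    rintro _ ⟨l, _, hl, rfl⟩
    exact S.wd_mem_GA hl
  exact this h

lemma x_mem_Kp {P : Fin n → Fin n → Prop} {i j} (h : P i j) : S.X i j ∈ S.Kp P :=
  Submodule.subset_span ⟨[(i, j)], by simp, by simpa using h, by simp [wd]⟩

lemma mem_Kp_of_homog {P : Fin n → Fin n → Prop} {y : A} (h : y ∈ S.GA P) {d : ℕ} (hd : 1 ≤ d)
    (hy : y ∈ Submodule.span ℚ {z | ∃ l, l.length = d ∧ z = S.wd l}) : y ∈ S.Kp P := by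
  have e : S.comp d y = y := by
    clear h
    induction hy using Submodule.span_induction with
    | mem z hz =>
      obtain ⟨l, hl, rfl⟩ := hz
      rw [comp_wd, if_pos hl]
    | zero => simp
    | add a b _ _ ha hb => rw [map_add, ha, hb]
    | smul r a _ ha => rw [map_smul, ha]
  rw [← e]
  replace h := S.GA_span h
  clear e hy
  induction h using Submodule.span_induction with
  | mem z hz =>
    obtain ⟨l, hl, rfl⟩ := hz
    rw [comp_wd]
    split_ifs with h
    · exact Submodule.subset_span ⟨l, by rintro rfl; simp at h; omega, hl, rfl⟩
    · exact zero_mem _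
  | zero => simp
  | add a b _ _ ha hb => rw [map_add]; exact add_mem ha hb
  | smul r a _ ha => rw [map_smul]; exact Submodule.smul_mem _ _ ha

lemma Kp_mul_x {P : Fin n → Fin n → Prop} {k : A} (hk : k ∈ S.Kp P) {i j} (h : P i j) :
    k * S.X i j ∈ S.Kp P := by
  induction hk using Submodule.span_induction with
  | mem z hz =>
    obtain ⟨l, hl, hP, rfl⟩ := hz
    refine Submodule.subset_span ⟨l ++ [(i, j)], by simp, ?_, by simp [wd]⟩
    intro p hp
    rcases List.mem_append.1 hp with h' | h'
    · exact hP p h'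
    · simp only [List.mem_singleton] at h'
      subst h'; exact h
  | zero => simp
  | add a b _ _ ha hb => rw [add_mul]; exact add_mem ha hb
  | smul r a _ ha => rw [smul_mul_assoc]; exact Submodule.smul_mem _ _ ha

/-- Span of `x_{ij} f` with `P i j` and `f` in `F d`. -/
def M (P : Fin n → Fin n → Prop) (d : ℕ) : Submodule ℚ A :=
  Submodule.span ℚ {z | ∃ i j, P i j ∧ ∃ f ∈ S.F d, z = S.X i j * f}

lemma comp_L {P : Fin n → Fin n → Prop} (d : ℕ) {y : A} (h : y ∈ S.Kp P * ⊤) :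
    S.comp d y ∈ S.M P d := by
  have ht : (⊤ : Submodule ℚ A) = Submodule.span ℚ {z | ∃ l, z = S.wd l} :=
    (Submodule.eq_top_iff'.2 S.top_span).symm
  rw [ht, Kp, Submodule.span_mul_span] at h
  induction h using Submodule.span_induction with
  | mem z hz =>
    obtain ⟨_, ⟨l, hl, hP, rfl⟩, _, ⟨m, rfl⟩, rfl⟩ := Set.mem_mul.1 hz
    rw [← wd_append, comp_wd]
    split_ifs with h
    · cases l with
      | nil => exact absurd rfl hl
      | cons p l =>
        refine Submodule.subset_span ⟨p.1, p.2, hP p (by simp), S.wd (l ++ m), ?_, ?_⟩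
        · apply S.wd_mem_F
          rw [← h]; simp
        · rw [List.cons_append, wd_cons]
    · exact zero_mem _
  | zero => simp
  | add a b _ _ ha hb => rw [map_add]; exact add_mem ha hb
  | smul r a _ ha => rw [map_smul]; exact Submodule.smul_mem _ _ ha

lemma Kp_mul_M {P : Fin n → Fin n → Prop} {d : ℕ} {k y : A} (hk : k ∈ S.Kp P)
    (hy : y ∈ S.M P d) : k * y ∈ S.Kp P * S.F d := by
  induction hy using Submodule.span_induction with
  | mem z hz =>
    obtain ⟨i, j, h, f, hf, rfl⟩ := hz
    rw [← mul_assoc]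
    exact Submodule.mul_mem_mul (S.Kp_mul_x hk h) hf
  | zero => simp
  | add a b _ _ ha hb => rw [mul_add]; exact add_mem ha hb
  | smul r a _ ha => rw [mul_smul_comm]; exact Submodule.smul_mem _ _ ha

lemma Kp_mul_W {P Q : Fin n → Fin n → Prop} {d : ℕ} {k z : A} (hk : k ∈ S.Kp P)
    (hz : z ∈ S.F (d + 1))
    (hW : z ∈ Subalgebra.toSubmodule (S.GA Q) ⊔ S.Kp P * ⊤ ⊔ S.F d) :
    k * z ∈ S.Kp P * Subalgebra.toSubmodule (S.GA Q) ⊔ S.Kp P * S.F d := by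
  obtain ⟨u, hu, f, hf, rfl⟩ := Submodule.mem_sup.1 hW
  obtain ⟨g, hg, h, hh, rfl⟩ := Submodule.mem_sup.1 hu
  have h1 := S.sub_comp_F hz
  rw [map_add, map_add, S.comp_F hf, add_zero] at h1
  set z := g + h + f
  have e : k * z = k * S.comp d g + (k * S.comp d h
      + k * (z - (S.comp d g + S.comp d h))) := by
    rw [← mul_add, ← mul_add]; congr 1; abel
  rw [e]
  refine Submodule.add_mem_sup (Submodule.mul_mem_mul hk (S.comp_GA d hg)) (add_mem ?_ ?_)
  · exact S.Kp_mul_M hk (S.comp_L d hh)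
  · exact Submodule.mul_mem_mul hk h1

/-! ### Properties of the coproduct -/

lemma cop_K {P : Fin n → Fin n → Prop} {V : Type} [AddCommGroup V] [Module ℚ V]
    (q : A →ₗ[ℚ] V) (hq : ∀ i j, P i j → ∀ b, q (S.X i j * b) = 0) {k : A} (hk : k ∈ S.GA P)
    (T : A ⊗[ℚ] A) :
    q.lTensor A (S.cop k T) = (LinearMap.mulLeft ℚ k).rTensor V (q.lTensor A T) := by
  induction hk using Algebra.adjoin_induction generalizing T with
  | mem z hz =>
    obtain ⟨i, j, h, rfl⟩ := hz
    rw [cop_x]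
    induction T using TensorProduct.induction_on with
    | zero => simp
    | tmul a b => simp [op_tmul, hq i j h]
    | add a b ha hb => simp only [map_add, ha, hb]
  | algebraMap r =>
    rw [AlgHom.commutes]
    induction T using TensorProduct.induction_on with
    | zero => simp
    | tmul a b => simp [Algebra.algebraMap_eq_smul_one, TensorProduct.smul_tmul']
    | add a b ha hb => simp only [map_add, ha, hb]
  | add a b _ _ ha hb =>
    rw [map_add, LinearMap.add_apply, map_add, ha, hb]
    have : LinearMap.mulLeft ℚ (a + b) = LinearMap.mulLeft ℚ a + LinearMap.mulLeft ℚ b := by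
      ext; simp [add_mul]
    rw [this, LinearMap.rTensor_add]
    rfl
  | mul a b _ _ ha hb =>
    rw [map_mul, Module.End.mul_apply, ha, hb, LinearMap.mulLeft_mul, LinearMap.rTensor_comp]
    rfl

lemma cop_GA {Q : Fin n → Fin n → Prop} {V : Type} [AddCommGroup V] [Module ℚ V]
    (q : A →ₗ[ℚ] V) (hq : ∀ b ∈ S.GA Q, q b = 0) {y : A} (hy : y ∈ S.GA Q) :
    q.lTensor A (S.cop y (1 ⊗ₜ 1)) = 0 := by
  have key : ∀ T ∈ Submodule.span ℚ {T : A ⊗[ℚ] A | ∃ a, ∃ b ∈ S.GA Q, T = a ⊗ₜ b},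
      S.cop y T ∈ Submodule.span ℚ {T : A ⊗[ℚ] A | ∃ a, ∃ b ∈ S.GA Q, T = a ⊗ₜ b} := by
    induction hy using Algebra.adjoin_induction with
    | mem z hz =>
      obtain ⟨i, j, h, rfl⟩ := hz
      intro T hT
      rw [cop_x]
      induction hT using Submodule.span_induction with
      | mem z hz =>
        obtain ⟨a, b, hb, rfl⟩ := hz
        rw [op_tmul]
        exact add_mem (Submodule.subset_span ⟨_, b, hb, rfl⟩)
          (Submodule.subset_span ⟨_, _, mul_mem (S.x_mem_GA h) hb, rfl⟩)
      | zero => simp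
      | add a b _ _ ha hb => rw [map_add]; exact add_mem ha hb
      | smul r a _ ha => rw [map_smul]; exact Submodule.smul_mem _ _ ha
    | algebraMap r =>
      intro T hT
      rw [AlgHom.commutes]
      exact Submodule.smul_mem _ r hT
    | add a b _ _ ha hb =>
      intro T hT
      rw [map_add]
      exact add_mem (ha T hT) (hb T hT)
    | mul a b _ _ ha hb =>
      intro T hT
      rw [map_mul]
      exact ha _ (hb T hT)
  have h := key (1 ⊗ₜ 1) (Submodule.subset_span ⟨1, 1, one_mem _, rfl⟩)
  generalize S.cop y (1 ⊗ₜ 1) = T at h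
  induction h using Submodule.span_induction with
  | mem z hz =>
    obtain ⟨a, b, hb, rfl⟩ := hz
    simp [hq b hb]
  | zero => simp
  | add a b _ _ ha hb => rw [map_add, ha, hb, add_zero]
  | smul r a _ ha => rw [map_smul, ha, smul_zero]

lemma cop_wd (l) : S.cop (S.wd l) (1 ⊗ₜ 1) - 1 ⊗ₜ S.wd l ∈
    Submodule.span ℚ {T : A ⊗[ℚ] A | ∃ a, ∃ b ∈ S.F l.length, T = a ⊗ₜ b} := by
  induction l with
  | nil => simp [wd_nil]
  | cons p l ih =>
    set T := S.cop (S.wd l) (1 ⊗ₜ 1) - 1 ⊗ₜ S.wd l with hT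
    have e : S.cop (S.wd (p :: l)) (1 ⊗ₜ 1) - 1 ⊗ₜ S.wd (p :: l) =
        S.X p.1 p.2 ⊗ₜ S.wd l + S.op p.1 p.2 T := by
      rw [wd_cons, map_mul, Module.End.mul_apply, cop_x, hT, map_sub, op_tmul, map_one, mul_one]
      abel
    rw [e]
    refine add_mem (Submodule.subset_span ⟨_, _, S.wd_mem_F (by simp), rfl⟩) ?_
    clear_value T
    clear hT e
    induction ih using Submodule.span_induction with
    | mem z hz =>
      obtain ⟨a, b, hb, rfl⟩ := hz
      rw [op_tmul]
      exact add_mem (Submodule.subset_span ⟨_, b, S.F_mono (by simp) hb, rfl⟩)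
          (Submodule.subset_span ⟨_, _, S.x_mul_F _ _ hb, rfl⟩)
    | zero => simp
    | add a b _ _ ha hb => rw [map_add]; exact add_mem ha hb
    | smul r a _ ha => rw [map_smul]; exact Submodule.smul_mem _ _ ha

lemma cop_F {d : ℕ} {V : Type} [AddCommGroup V] [Module ℚ V]
    (q : A →ₗ[ℚ] V) (hq : ∀ b ∈ S.F d, q b = 0) {y : A} (hy : y ∈ S.F (d + 1)) :
    q.lTensor A (S.cop y (1 ⊗ₜ 1)) = 1 ⊗ₜ q y := by
  induction hy using Submodule.span_induction with
  | mem z hz =>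
    obtain ⟨l, hl, rfl⟩ := hz
    have h := S.cop_wd l
    rw [← sub_eq_zero, ← LinearMap.lTensor_tmul, ← map_sub]
    generalize S.cop (S.wd l) (1 ⊗ₜ 1) - 1 ⊗ₜ S.wd l = T at h
    induction h using Submodule.span_induction with
    | mem z hz =>
      obtain ⟨a, b, hb, rfl⟩ := hz
      simp [hq b (S.F_mono (by omega) hb)]
    | zero => simp
    | add a b _ _ ha hb => rw [map_add, ha, hb, add_zero]
    | smul r a _ ha => rw [map_smul, ha, smul_zero]
  | zero => simp
  | add a b _ _ ha hb =>
    rw [map_add, LinearMap.add_apply, map_add, ha, hb, map_add, TensorProduct.tmul_add]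
  | smul r a _ ha =>
    rw [map_smul, LinearMap.smul_apply, map_smul, ha, map_smul, TensorProduct.tmul_smul]

/-! ### The main argument -/

lemma exists_coords {P : Fin n → Fin n → Prop} {d : ℕ} {ι : Type} (b : Module.Basis ι ℚ (S.Kp P))
    {t : A} (ht : t ∈ S.Kp P * S.F d) :
    ∃ c : ι →₀ A, (∀ j, c j ∈ S.F d) ∧ t = c.sum fun j f => (b j : A) * f := by
  induction ht using Submodule.mul_induction_on' with
  | mem_mul_mem k hk f hf =>
    refine ⟨(b.repr ⟨k, hk⟩).mapRange (fun r => r • f) (zero_smul _ _), ?_, ?_⟩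
    · intro j
      rw [Finsupp.mapRange_apply]
      exact Submodule.smul_mem _ _ hf
    · rw [Finsupp.sum_mapRange_index (by simp)]
      have := congrArg Subtype.val (b.linearCombination_repr ⟨k, hk⟩)
      rw [Finsupp.linearCombination_apply, Finsupp.sum, AddSubmonoidClass.coe_finsetSum] at this
      simp only at this
      conv_lhs => rw [← this]
      rw [Finset.sum_mul, Finsupp.sum]
      simp
  | add a _ b' _ ha hb =>
    obtain ⟨c, hc, rfl⟩ := ha
    obtain ⟨c', hc', rfl⟩ := hb
    refine ⟨c + c', fun j => add_mem (hc j) (hc' j), ?_⟩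
    rw [Finsupp.sum_add_index' (by simp) (by simp [mul_add])]

lemma step {P Q : Fin n → Fin n → Prop} {d : ℕ} {t : A}
    (ht : t ∈ S.Kp P * S.F (d + 1)) (htG : t ∈ S.GA Q) :
    t ∈ S.Kp P * Subalgebra.toSubmodule (S.GA Q) ⊔ S.Kp P * S.F d := by
  classical
  set b := Module.Basis.ofVectorSpace ℚ (S.Kp P)
  obtain ⟨c, hc, rfl⟩ := S.exists_coords b ht
  set W := Subalgebra.toSubmodule (S.GA Q) ⊔ S.Kp P * ⊤ ⊔ S.F d with hW
  have h0 := S.cop_GA W.mkQ (fun y hy => by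
    rw [Submodule.mkQ_apply, Submodule.Quotient.mk_eq_zero]
    exact Submodule.mem_sup_left (Submodule.mem_sup_left hy)) htG
  have h1 : W.mkQ.lTensor A (S.cop (c.sum fun j f => (b j : A) * f) (1 ⊗ₜ 1)) =
      c.sum fun j f => (b j : A) ⊗ₜ W.mkQ f := by
    rw [Finsupp.sum, Finsupp.sum, map_sum, LinearMap.sum_apply, map_sum]
    refine Finset.sum_congr rfl fun j _ => ?_
    rw [map_mul, Module.End.mul_apply, S.cop_K (P := P) W.mkQ ?_ (S.Kp_le_GA (b j).2),
      S.cop_F W.mkQ ?_ (hc j)]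
    · simp
    · intro y hy
      rw [Submodule.mkQ_apply, Submodule.Quotient.mk_eq_zero]
      exact Submodule.mem_sup_right hy
    · intro i j h y
      rw [Submodule.mkQ_apply, Submodule.Quotient.mk_eq_zero]
      exact Submodule.mem_sup_left (Submodule.mem_sup_right
        (Submodule.mul_mem_mul (S.x_mem_Kp h) trivial))
  rw [h0] at h1
  refine Submodule.sum_mem _ fun j _ => S.Kp_mul_W (b j).2 (hc j) ?_
  obtain ⟨ψ, hψ⟩ := LinearMap.exists_extend (b.coord j)
  have hψ' : ∀ i, ψ (b i) = if i = j then 1 else 0 := by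
    intro i
    have := DFunLike.congr_fun hψ (b i)
    simp only [LinearMap.comp_apply, Submodule.subtype_apply, Module.Basis.coord_apply,
      Module.Basis.repr_self, Finsupp.single_apply] at this
    exact this
  have h2 := congrArg (fun T => TensorProduct.lid ℚ _ (ψ.rTensor _ T)) h1
  simp only [map_zero, Finsupp.sum, map_sum, LinearMap.rTensor_tmul, TensorProduct.lid_tmul, hψ',
    ite_smul, one_smul, zero_smul, Finset.sum_ite_eq'] at h2
  rw [← hW, ← Submodule.Quotient.mk_eq_zero, ← Submodule.mkQ_apply]
  split_ifs at h2
  exact h2.symm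

theorem main {P Q : Fin n → Fin n → Prop} (hPQ : ∀ i j, P i j → Q i j) {y : A}
    (hy : y ∈ S.Kp P * ⊤) (hyG : y ∈ S.GA Q) :
    y ∈ S.Kp P * Subalgebra.toSubmodule (S.GA Q) := by
  have hJ : S.Kp P * Subalgebra.toSubmodule (S.GA Q) ≤ Subalgebra.toSubmodule (S.GA Q) := by
    apply Submodule.mul_le.2
    intro k hk g hg
    have hk' : k ∈ S.GA Q :=
      Algebra.adjoin_mono (by rintro z ⟨i, j, h, e⟩; exact ⟨i, j, hPQ i j h, e⟩) (S.Kp_le_GA hk)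
    exact (S.GA Q).mul_mem hk' hg
  have ind : ∀ d, y ∈ S.Kp P * Subalgebra.toSubmodule (S.GA Q) ⊔ S.Kp P * S.F d →
      y ∈ S.Kp P * Subalgebra.toSubmodule (S.GA Q) := by
    intro d
    induction d with
    | zero => intro h; simpa [F_zero] using h
    | succ d ih =>
      intro h
      apply ih
      obtain ⟨a, ha, t, ht, rfl⟩ := Submodule.mem_sup.1 h
      have htG : t ∈ S.GA Q := by
        have := sub_mem hyG (hJ ha : a ∈ S.GA Q)
        simpa using this
      exact add_mem (Submodule.mem_sup_left ha) (S.step ht htG)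
  have : ∃ d, y ∈ S.Kp P * S.F d := by
    clear hyG ind
    induction hy using Submodule.mul_induction_on' with
    | mem_mul_mem k hk f hf =>
      obtain ⟨d, hd⟩ := S.exists_F f
      exact ⟨d, Submodule.mul_mem_mul hk hd⟩
    | add a _ b _ ha hb =>
      obtain ⟨d, hd⟩ := ha
      obtain ⟨e, he⟩ := hb
      exact ⟨max d e, add_mem (mul_le_mul' le_rfl (S.F_mono (le_max_left _ _)) hd)
        (mul_le_mul' le_rfl (S.F_mono (le_max_right _ _)) he)⟩
  obtain ⟨d, hd⟩ := this
  exact ind d (Submodule.mem_sup_right hd)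

end FKA

/-! ### Application to `E n` -/

lemma x_diag (n : ℕ) (i : Fin n) : x n i i = 0 := by
  have := RingQuot.mkAlgHom_rel ℚ (Rel.diag (n := n) i)
  simpa [x] using this

lemma x_antisymm (n : ℕ) (i j : Fin n) : x n j i = - x n i j := by
  by_cases h : i = j
  · subst h; simp [x_diag]
  have := RingQuot.mkAlgHom_rel ℚ (Rel.antisymm (n := n) i j h)
  simpa [x] using this

lemma x_square (n : ℕ) (i j : Fin n) : x n i j * x n i j = 0 := by
  by_cases h : i = j
  · subst h; simp [x_diag]
  have := RingQuot.mkAlgHom_rel ℚ (Rel.square (n := n) i j h)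
  simpa [x] using this

lemma x_comm (n : ℕ) (i j k l : Fin n) (h : List.Nodup [i, j, k, l]) :
    x n i j * x n k l = x n k l * x n i j := by
  have := RingQuot.mkAlgHom_rel ℚ (Rel.comm (n := n) i j k l h)
  simpa [x] using this

lemma x_cyclic (n : ℕ) (i j k : Fin n) (h : List.Nodup [i, j, k]) :
    x n i j * x n j k + x n j k * x n k i + x n k i * x n i j = 0 := by
  have := RingQuot.mkAlgHom_rel ℚ (Rel.cyclic (n := n) i j k h)
  simpa [x] using this

lemma x_gen (n : ℕ) : Algebra.adjoin ℚ {y | ∃ i j : Fin n, y = x n i j} = ⊤ := by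
  rw [eq_top_iff]
  rintro y -
  obtain ⟨a, rfl⟩ := RingQuot.mkAlgHom_surjective ℚ (Rel n) y
  induction a using FreeAlgebra.induction with
  | grade0 r => rw [AlgHom.commutes]; exact Subalgebra.algebraMap_mem _ r
  | grade1 p => exact Algebra.subset_adjoin ⟨p.1, p.2, rfl⟩
  | mul a b ha hb => rw [map_mul]; exact mul_mem ha hb
  | add a b ha hb => rw [map_add]; exact add_mem ha hb

lemma x_lift (n : ℕ) (B : Type) [Ring B] [Algebra ℚ B] (f : Fin n → Fin n → B)
    (h : Rels n B f) : ∃ F : E n →ₐ[ℚ] B, ∀ i j, F (x n i j) = f i j := by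
  refine ⟨RingQuot.liftAlgHom ℚ ⟨FreeAlgebra.lift ℚ (fun p : Fin n × Fin n => f p.1 p.2), ?_⟩, ?_⟩
  · intro a b hab
    cases hab with
    | diag i => simpa using h.diag i
    | antisymm i j _ => simpa using h.antisymm i j
    | square i j _ => simpa using h.square i j
    | comm i j k l h' => simpa using h.comm i j k l h'
    | cyclic i j k h' => simpa using h.cyclic i j k h'
  · intro i j
    simp [x]

/-- `E n` has the universal property. -/
noncomputable def fka (n : ℕ) : FKA n (E n) where
  X := x n
  rels := ⟨x_diag n, x_antisymm n, x_square n, x_comm n, x_cyclic n⟩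
  gen := x_gen n
  lift B _ _ f h := x_lift n B f h

lemma EGplus_eq (n : ℕ) (H : SimpleGraph (Fin n)) : EGplus n H = (fka n).Kp H.Adj := by
  apply le_antisymm
  · refine iSup_le fun d => iSup_le fun hd => ?_
    rintro y ⟨hy1, hy2⟩
    refine (fka n).mem_Kp_of_homog (P := H.Adj) hy1 hd ?_
    refine Submodule.span_mono ?_ hy2
    rintro _ ⟨l, -, hl, rfl⟩
    exact ⟨l, hl, rfl⟩
  · apply Submodule.span_le.2
    rintro _ ⟨l, hl, hP, rfl⟩
    have h1 : (fka n).wd l ∈ EGdeg n H l.length :=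
      ⟨(fka n).wd_mem_GA hP, Submodule.subset_span ⟨l, fun p hp => (hP p hp).ne, rfl, rfl⟩⟩
    have h2 : 1 ≤ l.length := List.length_pos_of_ne_nil hl
    exact (le_iSup₂_of_le (f := fun d (_ : 1 ≤ d) => EGdeg n H d) l.length h2 le_rfl) h1

/-- if `H` is a subgraph of `G`, then `(E_H⁺·E_n) ∩ E_G = E_H⁺·E_G` as
`ℚ`-subspaces of `E n`. -/
theorem stmt12 (n : ℕ) (hn : 1 ≤ n) (G H : SimpleGraph (Fin n)) (hHG : H ≤ G) :
    Submodule.span ℚ {y : E n | ∃ h ∈ EGplus n H, ∃ p : E n, y = h * p} ⊓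
        (EG n G).toSubmodule =
      Submodule.span ℚ {y : E n | ∃ h ∈ EGplus n H, ∃ g ∈ EG n G, y = h * g} := by
  apply le_antisymm
  · rintro y ⟨hy, hyG⟩
    have h1 : y ∈ (fka n).Kp H.Adj * ⊤ := by
      refine Submodule.span_le.2 ?_ hy
      rintro _ ⟨h, hh, p, rfl⟩
      rw [EGplus_eq] at hh
      exact Submodule.mul_mem_mul hh trivial
    have h2 := (fka n).main (Q := G.Adj) (fun i j h => hHG h) h1 hyG
    refine Submodule.mul_le.2 ?_ h2
    intro k hk g hg
    rw [← EGplus_eq] at hk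
    exact Submodule.subset_span ⟨k, hk, g, hg, rfl⟩
  · apply Submodule.span_le.2
    rintro _ ⟨h, hh, g, hg, rfl⟩
    refine ⟨Submodule.subset_span ⟨h, hh, g, rfl⟩, ?_⟩
    rw [EGplus_eq] at hh
    have h1 : h ∈ EG n H := (fka n).Kp_le_GA hh
    have h2 : h ∈ EG n G :=
      Algebra.adjoin_mono (by rintro z ⟨i, j, h, e⟩; exact ⟨i, j, hHG h, e⟩) h1
    exact (EG n G).mul_mem h2 hg

end FK
end
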